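/- arXiv:0906.2341 — 3 statements merged into one kernel-verified Lean document; each statement's English description precedes it below -/
import Mathlib

section
/- (Comparison theorem.) With paths γ_{xy} fixed as in the context and c = max over edges (z,w) ∈ E_P of (1/(π_P(z) P(z,w))) · Σ_{(x,y) : γ_{xy} ∋ (z,w)} |γ_{xy}| π_Q(x) Q(x,y), the Dirichlet forms satisfy E_Q(f,f) ≤ c · E_P(f,f) for every function f on X. -/
open scoped Classical

noncomputable section

/-- Loop erasure: the increment of `f` along a walk is bounded by the sum of the absolute
increments over the set of edges used by the walk, each edge being counted once. -/
theorem abs_sub_le_sum_edges {X : Type*} [DecidableEq X] (f : X → ℝ) (n : ℕ) :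
    ∀ (l : List X) (x y : X), l.length ≤ n → l.head? = some x → l.getLast? = some y →
      |f x - f y| ≤ ∑ e ∈ (l.zip l.tail).toFinset, |f e.1 - f e.2| := by
  induction n with
  | zero =>
    intro l x y hl hx
    simp_all
  | succ n ih =>
    intro l x y hl hx hy
    match l, hl, hx, hy with
    | [a], _, hx, hy => simp_all
    | a :: b :: t, hl, hx, hy =>
      obtain rfl : a = x := by simpa using hx
      by_cases ha : a ∈ b :: t
      · obtain ⟨s, u, hsu⟩ := List.append_of_mem ha
        rw [hsu] at hl hy ⊢
        refine (ih (a :: u) a y ?_ rfl ?_).trans ?_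
        · simp at hl ⊢
          omega
        · rwa [← List.cons_append, List.getLast?_append_of_ne_nil _ (List.cons_ne_nil a u)] at hy
        · refine Finset.sum_le_sum_of_subset_of_nonneg ?_ fun _ _ _ => abs_nonneg _
          intro e he
          rw [List.mem_toFinset] at he ⊢
          have key : ∀ s' : List X, ∀ e ∈ (a :: u).zip u,
              e ∈ (s' ++ a :: u).zip (s' ++ a :: u).tail := by
            intro s'
            induction s' with
            | nil => exact fun e he => he
            | cons c s' ihs =>
              intro e he
              have h := ihs e he
              cases s' <;> exact List.mem_cons_of_mem _ h
          exact key (a :: s) e he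
      · have hnot : (a, b) ∉ ((b :: t).zip t).toFinset := by
          rw [List.mem_toFinset]
          exact fun h => ha (List.of_mem_zip h).1
        have hstep := ih (b :: t) b y (by simpa using hl) rfl (by simpa using hy)
        simp only [List.tail_cons] at hstep ⊢
        rw [List.zip_cons_cons, List.toFinset_cons, Finset.sum_insert hnot]
        exact (abs_sub_le _ (f b) _).trans (by gcongr)

/-- Cauchy–Schwarz along a walk, each edge being counted once. -/
theorem sq_sub_le_length_mul_sum_edges {X : Type*} [DecidableEq X] (f : X → ℝ)
    {l : List X} {x y : X} (hx : l.head? = some x) (hy : l.getLast? = some y) :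
    (f x - f y) ^ 2 ≤
      ((l.length - 1 : ℕ) : ℝ) * ∑ e ∈ (l.zip l.tail).toFinset, (f e.1 - f e.2) ^ 2 := by
  have hcard : (l.zip l.tail).toFinset.card ≤ l.length - 1 :=
    (List.toFinset_card_le _).trans (by simp)
  calc (f x - f y) ^ 2 = |f x - f y| ^ 2 := (sq_abs _).symm
    _ ≤ (∑ e ∈ (l.zip l.tail).toFinset, |f e.1 - f e.2|) ^ 2 := by
        gcongr
        exact abs_sub_le_sum_edges f _ l x y le_rfl hx hy
    _ ≤ (l.zip l.tail).toFinset.card *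
          ∑ e ∈ (l.zip l.tail).toFinset, |f e.1 - f e.2| ^ 2 := sq_sum_le_card_mul_sum_sq
    _ ≤ _ := by
        simp only [sq_abs]
        gcongr

theorem List.IsChain.rel_of_mem_zip_tail {X : Type*} {R : X → X → Prop} {z w : X} :
    ∀ {l : List X}, l.IsChain R → (z, w) ∈ l.zip l.tail → R z w
  | [], _, h => by simp at h
  | [_], _, h => by simp at h
  | a :: b :: t, hc, h => by
    rw [List.isChain_cons_cons] at hc
    rw [List.tail_cons, List.zip_cons_cons, List.mem_cons, Prod.mk.injEq] at h
    rcases h with ⟨rfl, rfl⟩ | h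
    · exact hc.1
    · exact hc.2.rel_of_mem_zip_tail h

/-- comparison theorem of Diaconis–Saloff-Coste: with canonical paths
`Γ x y` for the edges of `Q` using edges of `P`, and
`c = max_{(z,w) ∈ E_P} (1/(π_P(z)P(z,w))) Σ_{γ_{xy} ∋ (z,w)} |γ_{xy}| π_Q(x) Q(x,y)`,
one has `𝓔_Q(f,f) ≤ c · 𝓔_P(f,f)` for every `f`. -/
theorem stmt2 {X : Type*} [Fintype X] [DecidableEq X]
    (P Q : X → X → ℝ) (piP piQ : X → ℝ)
    (hPnn : ∀ x y, 0 ≤ P x y) (hProw : ∀ x, ∑ y, P x y = 1)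
    (hQnn : ∀ x y, 0 ≤ Q x y) (hQrow : ∀ x, ∑ y, Q x y = 1)
    (hpiPnn : ∀ x, 0 ≤ piP x) (hpiPsum : ∑ x, piP x = 1)
    (hpiQnn : ∀ x, 0 ≤ piQ x) (hpiQsum : ∑ x, piQ x = 1)
    (hPrev : ∀ x y, piP x * P x y = piP y * P y x)
    (hQrev : ∀ x y, piQ x * Q x y = piQ y * Q y x)
    -- the canonical paths: for each `Q`-edge `(x,y)` with `x ≠ y`, a path from `x`
    -- to `y` whose steps are edges of `P`
    (Γ : X → X → List X)
    (hΓ : ∀ x y, x ≠ y → 0 < piQ x * Q x y →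
      (Γ x y).head? = some x ∧ (Γ x y).getLast? = some y ∧
      (Γ x y).Chain' (fun a b => 0 < piP a * P a b)) :
    ∀ f : X → ℝ,
      (1 / 2) * ∑ x, ∑ y, (f x - f y) ^ 2 * (piQ x * Q x y) ≤
        (sSup {r : ℝ | ∃ z w, 0 < piP z * P z w ∧
            r = (piP z * P z w)⁻¹ *
              ∑ x, ∑ y,
                (if x ≠ y ∧ 0 < piQ x * Q x y ∧ (z, w) ∈ (Γ x y).zip (Γ x y).tail then
                  (((Γ x y).length - 1 : ℕ) : ℝ) * (piQ x * Q x y) else 0)}) *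
          ((1 / 2) * ∑ x, ∑ y, (f x - f y) ^ 2 * (piP x * P x y)) := by
  intro f
  set L : X → X → X → X → ℝ := fun z w x y =>
    if x ≠ y ∧ 0 < piQ x * Q x y ∧ (z, w) ∈ (Γ x y).zip (Γ x y).tail then
      (((Γ x y).length - 1 : ℕ) : ℝ) * (piQ x * Q x y) else 0 with hL
  change _ ≤ sSup {r : ℝ | ∃ z w, 0 < piP z * P z w ∧
    r = (piP z * P z w)⁻¹ * ∑ x, ∑ y, L z w x y} * _
  set c := sSup {r : ℝ | ∃ z w, 0 < piP z * P z w ∧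
    r = (piP z * P z w)⁻¹ * ∑ x, ∑ y, L z w x y} with hc
  have hbdd : BddAbove {r : ℝ | ∃ z w, 0 < piP z * P z w ∧
      r = (piP z * P z w)⁻¹ * ∑ x, ∑ y, L z w x y} := by
    refine ((Set.finite_range fun e : X × X =>
      (piP e.1 * P e.1 e.2)⁻¹ * ∑ x, ∑ y, L e.1 e.2 x y).subset ?_).bddAbove
    rintro r ⟨z, w, -, rfl⟩
    exact ⟨(z, w), rfl⟩
  have hload : ∀ z w, ∑ x, ∑ y, L z w x y ≤ c * (piP z * P z w) := by
    intro z w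
    rcases (mul_nonneg (hpiPnn z) (hPnn z w)).eq_or_lt with h0 | hpos
    · rw [← h0, mul_zero]
      refine (Finset.sum_eq_zero fun x _ => Finset.sum_eq_zero fun y _ => if_neg ?_).le
      rintro ⟨hxy, hq, hmem⟩
      exact ((hΓ x y hxy hq).2.2.rel_of_mem_zip_tail hmem).ne h0
    · have h := le_csSup hbdd ⟨z, w, hpos, rfl⟩
      rwa [inv_mul_le_iff₀ hpos, mul_comm] at h
  have hedge : ∀ x y, (f x - f y) ^ 2 * (piQ x * Q x y) ≤
      ∑ z, ∑ w, (f z - f w) ^ 2 * L z w x y := by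
    intro x y
    have hLnn : ∀ z w, 0 ≤ L z w x y := by
      intro z w
      have := mul_nonneg (hpiQnn x) (hQnn x y)
      simp only [hL]
      split_ifs <;> positivity
    have hnn : 0 ≤ ∑ z, ∑ w, (f z - f w) ^ 2 * L z w x y :=
      Finset.sum_nonneg fun z _ => Finset.sum_nonneg fun w _ =>
        mul_nonneg (sq_nonneg _) (hLnn z w)
    rcases (mul_nonneg (hpiQnn x) (hQnn x y)).eq_or_lt with h0 | hq
    · rwa [← h0, mul_zero]
    by_cases hxy : x = y
    · subst hxy
      simpa using hnn
    obtain ⟨hx, hy, -⟩ := hΓ x y hxy hq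
    calc (f x - f y) ^ 2 * (piQ x * Q x y)
        ≤ (((Γ x y).length - 1 : ℕ) : ℝ) *
            (∑ e ∈ ((Γ x y).zip (Γ x y).tail).toFinset, (f e.1 - f e.2) ^ 2) *
              (piQ x * Q x y) := by
          gcongr
          exact sq_sub_le_length_mul_sum_edges f hx hy
      _ = ∑ e ∈ ((Γ x y).zip (Γ x y).tail).toFinset, (f e.1 - f e.2) ^ 2 * L e.1 e.2 x y := by
          rw [Finset.mul_sum, Finset.sum_mul]
          refine Finset.sum_congr rfl fun e he => ?_
          have hLe : L e.1 e.2 x y = (((Γ x y).length - 1 : ℕ) : ℝ) * (piQ x * Q x y) :=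
            if_pos ⟨hxy, hq, List.mem_toFinset.1 he⟩
          rw [hLe]
          ring
      _ ≤ ∑ e : X × X, (f e.1 - f e.2) ^ 2 * L e.1 e.2 x y :=
          Finset.sum_le_sum_of_subset_of_nonneg (Finset.subset_univ _) fun e _ _ =>
            mul_nonneg (sq_nonneg _) (hLnn _ _)
      _ = _ := Fintype.sum_prod_type _
  rw [mul_left_comm]
  gcongr
  calc ∑ x, ∑ y, (f x - f y) ^ 2 * (piQ x * Q x y)
      ≤ ∑ x, ∑ y, ∑ z, ∑ w, (f z - f w) ^ 2 * L z w x y :=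
        Finset.sum_le_sum fun x _ => Finset.sum_le_sum fun y _ => hedge x y
    _ = ∑ e : X × X, ∑ d : X × X, (f d.1 - f d.2) ^ 2 * L d.1 d.2 e.1 e.2 := by
        simp only [Fintype.sum_prod_type]
    _ = ∑ d : X × X, ∑ e : X × X, (f d.1 - f d.2) ^ 2 * L d.1 d.2 e.1 e.2 := Finset.sum_comm
    _ = ∑ z, ∑ w, (f z - f w) ^ 2 * ∑ x, ∑ y, L z w x y := by
        simp only [Fintype.sum_prod_type, Finset.mul_sum]
    _ ≤ ∑ z, ∑ w, (f z - f w) ^ 2 * (c * (piP z * P z w)) := by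
        gcongr with z _ w _
        exact hload z w
    _ = c * ∑ z, ∑ w, (f z - f w) ^ 2 * (piP z * P z w) := by
        simp only [Finset.mul_sum, mul_left_comm]
end
end

section
/- For the mean-field Ising model π on {−1,+1}^M with parameter α > 0 and tempered densities π_k ∝ π^{k/M} for k = 0, …, M, the overlap of adjacent levels satisfies Σ_{z ∈ {−1,+1}^M} min{π_k(z), π_{k+1}(z)} ≥ exp{−α/2} for every k ∈ {0, …, M−1}. -/
noncomputable section

/-- A spin configuration in `{−1,+1}^M`. -/
abbrev SpinConf (M : ℕ) := Fin M → ({-1, 1} : Finset ℤ)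

/-- The total magnetization `Σ_i z_i`. -/
def spinSum {M : ℕ} (z : SpinConf M) : ℤ := ∑ i, (z i : ℤ)

/-- The mean-field Ising model:
`π(z) = (1/Z) exp{(α/(2M)) (Σ_i z_i)²}`. -/
def isingPi (α : ℝ) (M : ℕ) (z : SpinConf M) : ℝ :=
  Real.exp (α / (2 * M) * ((spinSum z : ℝ)) ^ 2) /
    ∑ w : SpinConf M, Real.exp (α / (2 * M) * ((spinSum w : ℝ)) ^ 2)

/-- The tempered density `π_k ∝ π^{k/M}`. -/
def isingTempered (α : ℝ) (M : ℕ) (k : ℕ) (z : SpinConf M) : ℝ :=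
  isingPi α M z ^ ((k : ℝ) / M) / ∑ w : SpinConf M, isingPi α M w ^ ((k : ℝ) / M)

/-- If two positive weights have ratio in `[a, a * C]`, then their normalizations overlap by at
least `C⁻¹`. -/
theorem inv_le_sum_min_normalized {ι : Type*} [Fintype ι] [Nonempty ι] {f g : ι → ℝ} {a C : ℝ}
    (hf : ∀ i, 0 < f i) (ha : 0 < a) (hC : 1 ≤ C)
    (hl : ∀ i, f i * a ≤ g i) (hu : ∀ i, g i ≤ f i * (a * C)) :
    C⁻¹ ≤ ∑ i, min (f i / ∑ j, f j) (g i / ∑ j, g j) := by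
  have hC0 : 0 < C := by linarith
  have hF : 0 < ∑ j, f j := Finset.sum_pos (fun i _ => hf i) Finset.univ_nonempty
  have hG : 0 < ∑ j, g j :=
    Finset.sum_pos (fun i _ => (mul_pos (hf i) ha).trans_le (hl i)) Finset.univ_nonempty
  have hGF : ∑ j, g j ≤ (∑ j, f j) * (a * C) := by
    rw [Finset.sum_mul]
    exact Finset.sum_le_sum fun i _ => hu i
  calc C⁻¹ = ∑ i, C⁻¹ * (f i / ∑ j, f j) := by
        rw [← Finset.mul_sum, ← Finset.sum_div, div_self hF.ne', mul_one]
    _ ≤ _ := Finset.sum_le_sum fun i _ => le_min ?_ ?_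
  · exact mul_le_of_le_one_left (div_pos (hf i) hF).le (inv_le_one_of_one_le₀ hC)
  · calc C⁻¹ * (f i / ∑ j, f j) = f i * a / ((∑ j, f j) * (a * C)) := by field_simp
      _ ≤ g i / ∑ j, g j :=
        div_le_div₀ ((mul_pos (hf i) ha).le.trans (hl i)) (hl i) hG hGF

theorem abs_spinSum_le {M : ℕ} (z : SpinConf M) : |spinSum z| ≤ M := by
  have h : ∀ i, |(z i : ℤ)| = 1 := fun i => by
    have hi := (z i).2
    simp only [Finset.mem_insert, Finset.mem_singleton] at hi
    rcases hi with hi | hi <;> simp [hi]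
  calc |spinSum z| ≤ ∑ i, |(z i : ℤ)| := Finset.abs_sum_le_sum_abs _ _
    _ = M := by simp [h]

theorem spinSum_sq_le {M : ℕ} (z : SpinConf M) : (spinSum z : ℝ) ^ 2 ≤ (M : ℝ) ^ 2 := by
  have h : |(spinSum z : ℝ)| ≤ M := by exact_mod_cast abs_spinSum_le z
  exact sq_le_sq.2 (h.trans (le_abs_self _))

/-- for the mean-field Ising model with tempered densities
`π_k ∝ π^{k/M}`, the overlap of adjacent levels satisfies
`Σ_z min{π_k(z), π_{k+1}(z)} ≥ exp{−α/2}`. -/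
theorem stmt16 (M : ℕ) (hM : 1 ≤ M) (α : ℝ) (hα : 0 < α) :
    ∀ k < M,
      Real.exp (-α / 2) ≤
        ∑ z : SpinConf M, min (isingTempered α M k z) (isingTempered α M (k + 1) z) := by
  intro k _
  have hM0 : (0 : ℝ) < M := by exact_mod_cast hM
  have : Nonempty (SpinConf M) := ⟨fun _ => ⟨1, by simp⟩⟩
  set Z := ∑ w : SpinConf M, Real.exp (α / (2 * M) * ((spinSum w : ℝ)) ^ 2) with hZ
  have hZ0 : 0 < Z := Finset.sum_pos (fun _ _ => Real.exp_pos _) Finset.univ_nonempty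
  have hpos : ∀ z, 0 < isingPi α M z := fun z => div_pos (Real.exp_pos _) hZ0
  have hroot : ∀ z, isingPi α M z ^ (1 / (M : ℝ)) =
      (Z ^ (1 / (M : ℝ)))⁻¹ * Real.exp (α / (2 * M) * (spinSum z : ℝ) ^ 2 * (1 / M)) := fun z => by
    rw [isingPi, ← hZ, Real.div_rpow (Real.exp_pos _).le hZ0.le, ← Real.exp_mul, div_eq_inv_mul]
  have hsucc : ∀ z, isingPi α M z ^ (((k + 1 : ℕ) : ℝ) / M) =
      isingPi α M z ^ ((k : ℝ) / M) * isingPi α M z ^ (1 / (M : ℝ)) := fun z => by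
    rw [← Real.rpow_add (hpos z), Nat.cast_add_one, add_div]
  have ha : 0 < (Z ^ (1 / (M : ℝ)))⁻¹ := inv_pos.2 (Real.rpow_pos_of_pos hZ0 _)
  rw [neg_div, Real.exp_neg]
  refine inv_le_sum_min_normalized (fun z => Real.rpow_pos_of_pos (hpos z) _) ha
    (Real.one_le_exp (by positivity)) (fun z => ?_) (fun z => ?_)
  · rw [hsucc, hroot]
    refine mul_le_mul_of_nonneg_left ?_ (Real.rpow_pos_of_pos (hpos z) _).le
    exact le_mul_of_one_le_right ha.le (Real.one_le_exp (by positivity))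
  · rw [hsucc, hroot]
    refine mul_le_mul_of_nonneg_left ?_ (Real.rpow_pos_of_pos (hpos z) _).le
    refine mul_le_mul_of_nonneg_left (Real.exp_le_exp.2 ?_) ha.le
    calc α / (2 * M) * (spinSum z : ℝ) ^ 2 * (1 / M)
        ≤ α / (2 * M) * (M : ℝ) ^ 2 * (1 / M) := by
          gcongr ?_ * ?_ * ?_
          exact spinSum_sq_le z
      _ = α / 2 := by field_simp
end
end

section
/- Let b > 0, M ∈ ℕ with M ≥ 1, and 0 < β' ≤ β with (β'/β)^{M/2} ≥ M^{−1/2}. Then ∫_{A_2} min{ N_M(z; b·1_M, β'^{−1} I_M), N_M(z; b·1_M, β^{−1} I_M) } λ(dz) ≥ (1/√M) · Φ(b √(Mβ)) ≥ 1/(2√M), where A_2 = {z ∈ ℝ^M : Σ_{i=1}^M z_i ≥ 0} and λ is Lebesgue measure on ℝ^M. -/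
open MeasureTheory

noncomputable section

/-- The multivariate normal density `N_M(z; ν·1_M, β⁻¹ I_M)` on `ℝ^M`:
`(2π)^{−M/2} β^{M/2} exp{−(β/2) Σ_i (z_i − ν)²}`. -/
def normalDens (M : ℕ) (ν β : ℝ) (z : Fin M → ℝ) : ℝ :=
  (2 * Real.pi) ^ (-(M : ℝ) / 2) * β ^ ((M : ℝ) / 2) *
    Real.exp (-(β / 2) * ∑ i, (z i - ν) ^ 2)

/-- The standard normal cumulative distribution function `Φ`. -/
def stdNormalCDF (x : ℝ) : ℝ :=
  ∫ t in Set.Iic x, (Real.sqrt (2 * Real.pi))⁻¹ * Real.exp (-(t ^ 2) / 2)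

/-- The half-space `A_2 = {z ∈ ℝ^M : Σ_i z_i ≥ 0}`. -/
def halfSpace (M : ℕ) : Set (Fin M → ℝ) := {z | 0 ≤ ∑ i, z i}

open ProbabilityTheory in
/-- A finite product of copies of the one-dimensional Gaussian with density `f` has density
`∏ i, f (z i)` with respect to Lebesgue measure. -/
theorem pi_gaussianReal_eq_withDensity {ι : Type*} [Fintype ι] (m : ℝ) {v : NNReal}
    (hv : v ≠ 0) :
    Measure.pi (fun _ : ι => gaussianReal m v) =
      (volume : Measure (ι → ℝ)).withDensity
        (fun z => ENNReal.ofReal (∏ i, gaussianPDFReal m v (z i))) := by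
  refine Measure.pi_eq fun s hs => ?_
  rw [withDensity_apply _ (MeasurableSet.univ_pi hs), volume_pi, Measure.restrict_pi_pi,
    ← ofReal_integral_eq_lintegral_ofReal, integral_fintype_prod_eq_prod,
    ENNReal.ofReal_prod_of_nonneg]
  · exact Finset.prod_congr rfl fun i _ => (gaussianReal_apply_eq_integral m hv (s i)).symm
  · exact fun i _ => integral_nonneg fun x => gaussianPDFReal_nonneg _ _ _
  · exact Integrable.fintype_prod fun i => (integrable_gaussianPDFReal m v).restrict
  · exact ae_of_all _ fun z => Finset.prod_nonneg fun i _ => gaussianPDFReal_nonneg _ _ _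

open ProbabilityTheory in
/-- The sum of `M` independent Gaussians of mean `m` and variance `v` is Gaussian of mean `M m`
and variance `M v`. -/
theorem map_sum_pi_gaussianReal (M : ℕ) (m : ℝ) (v : NNReal) :
    (Measure.pi (fun _ : Fin M => gaussianReal m v)).map (fun z => ∑ i, z i) =
      gaussianReal (M * m) (M * v) := by
  have : IsProbabilityMeasure
      ((Measure.pi (fun _ : Fin M => gaussianReal m v)).map (fun z => ∑ i, z i)) :=
    Measure.isProbabilityMeasure_map (by fun_prop)
  refine Measure.ext_of_charFun ?_
  rw [charFun_map_sum_pi_eq_prod]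
  ext t
  simp only [Finset.prod_const, Finset.card_univ, Fintype.card_fin, Pi.pow_apply,
    charFun_gaussianReal, ← Complex.exp_nat_mul]
  push_cast
  ring_nf

open ProbabilityTheory in
theorem normalDens_eq_prod_gaussianPDFReal (M : ℕ) (ν : ℝ) {β : ℝ} (hβ : 0 < β)
    (z : Fin M → ℝ) :
    normalDens M ν β z = ∏ i, gaussianPDFReal ν (Real.toNNReal β⁻¹) (z i) := by
  have hv : ((Real.toNNReal β⁻¹ : NNReal) : ℝ) = β⁻¹ := Real.coe_toNNReal _ (by positivity)
  have hc : (Real.sqrt (2 * Real.pi * β⁻¹))⁻¹ =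
      (2 * Real.pi) ^ (-(1 : ℝ) / 2) * β ^ ((1 : ℝ) / 2) := by
    rw [Real.sqrt_mul (by positivity), Real.sqrt_inv, mul_inv, inv_inv, Real.sqrt_eq_rpow,
      Real.sqrt_eq_rpow, ← Real.rpow_neg (by positivity), neg_div]
  simp only [gaussianPDFReal_def, hv, Finset.prod_mul_distrib, Finset.prod_const, Finset.card_univ,
    Fintype.card_fin, ← Real.exp_sum, hc]
  rw [← Real.rpow_mul_natCast (by positivity), ← Real.rpow_mul_natCast hβ.le, normalDens,
    Finset.mul_sum]
  congr 2
  · ring_nf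
  · ring_nf
  · refine Finset.sum_congr rfl fun i _ => ?_
    field_simp

theorem integrable_normalDens (M : ℕ) (ν : ℝ) {β : ℝ} (hβ : 0 < β) :
    Integrable (normalDens M ν β) := by
  simp_rw [funext (normalDens_eq_prod_gaussianPDFReal M ν hβ)]
  exact Integrable.fintype_prod fun i => ProbabilityTheory.integrable_gaussianPDFReal _ _

theorem measurableSet_halfSpace (M : ℕ) : MeasurableSet (halfSpace M) :=
  measurableSet_le measurable_const (by fun_prop)

theorem normalDens_nonneg (M : ℕ) (ν : ℝ) {β : ℝ} (hβ : 0 < β) (z : Fin M → ℝ) :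
    0 ≤ normalDens M ν β z := by
  unfold normalDens
  positivity

open ProbabilityTheory in
theorem stdNormalCDF_eq_gaussianReal_real (x : ℝ) :
    stdNormalCDF x = (gaussianReal 0 1).real (Set.Iic x) := by
  rw [measureReal_def, gaussianReal_apply_eq_integral 0 one_ne_zero, ENNReal.toReal_ofReal
    (integral_nonneg fun x => gaussianPDFReal_nonneg _ _ _)]
  simp [stdNormalCDF, gaussianPDFReal_def]

open ProbabilityTheory in
theorem half_le_stdNormalCDF {x : ℝ} (hx : 0 ≤ x) : 1 / 2 ≤ stdNormalCDF x := by
  rw [stdNormalCDF_eq_gaussianReal_real]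
  have hsymm : (gaussianReal 0 1).real (Set.Ici 0) = (gaussianReal 0 1).real (Set.Iic 0) := by
    have h := gaussianReal_map_neg (μ := 0) (v := 1)
    rw [neg_zero] at h
    conv_lhs => rw [← h]
    rw [map_measureReal_apply measurable_neg measurableSet_Ici]
    simp
  have hcover : (1 : ℝ) ≤
      (gaussianReal 0 1).real (Set.Iic 0) + (gaussianReal 0 1).real (Set.Ici 0) := by
    rw [← probReal_univ (μ := gaussianReal 0 1), ← Set.Iic_union_Ici (a := (0 : ℝ))]
    exact measureReal_union_le _ _
  have hmono : (gaussianReal 0 1).real (Set.Iic 0) ≤ (gaussianReal 0 1).real (Set.Iic x) :=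
    measureReal_mono (Set.Iic_subset_Iic.mpr hx)
  linarith

open ProbabilityTheory in
/-- The mass that `N_M(b·1_M, β⁻¹ I_M)` gives to the half-space is `Φ(b √(Mβ))`. -/
theorem setIntegral_halfSpace_normalDens (b : ℝ) {M : ℕ} (hM : 1 ≤ M) {β : ℝ} (hβ : 0 < β) :
    ∫ z in halfSpace M, normalDens M b β z = stdNormalCDF (b * Real.sqrt (M * β)) := by
  have hM0 : (0 : ℝ) < M := by exact_mod_cast hM
  set v := Real.toNNReal β⁻¹
  have hv : v ≠ 0 := by simpa [v] using hβ
  set c := Real.sqrt (M / β)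
  have hc : 0 < c := Real.sqrt_pos.mpr (by positivity)
  have hcc : c ^ 2 = M / β := Real.sq_sqrt (by positivity)
  have hlaw : (gaussianReal 0 1).map (fun x => M * b - c * x) = gaussianReal (M * b) (M * v) := by
    have hcomp : (fun x : ℝ => M * b - c * x) = (fun y => M * b - y) ∘ (fun x => c * x) := rfl
    rw [hcomp, ← Measure.map_map (by fun_prop) (by fun_prop), gaussianReal_map_const_mul,
      gaussianReal_map_const_sub]
    congr 1
    · simp
    · ext
      simp [v, hcc, hβ.le, div_eq_mul_inv]
  have hset : (fun x : ℝ => M * b - c * x) ⁻¹' Set.Ici 0 = Set.Iic (b * Real.sqrt (M * β)) := by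
    have hcs : c * Real.sqrt (M * β) = M := by
      rw [← Real.sqrt_mul (by positivity), show (M : ℝ) / β * (M * β) = M ^ 2 by field_simp,
        Real.sqrt_sq hM0.le]
    ext x
    simp only [Set.mem_preimage, Set.mem_Ici, Set.mem_Iic, sub_nonneg]
    rw [show M * b = c * (b * Real.sqrt (M * β)) by rw [mul_left_comm, hcs, mul_comm],
      mul_le_mul_iff_right₀ hc]
  have hmass : (Measure.pi (fun _ : Fin M => gaussianReal b v)) (halfSpace M) =
      gaussianReal 0 1 (Set.Iic (b * Real.sqrt (M * β))) := by
    rw [← hset, ← Measure.map_apply (by fun_prop) measurableSet_Ici, hlaw,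
      ← map_sum_pi_gaussianReal, Measure.map_apply (by fun_prop) measurableSet_Ici]
    rfl
  rw [stdNormalCDF_eq_gaussianReal_real, measureReal_def, ← hmass,
    pi_gaussianReal_eq_withDensity b hv, withDensity_apply _ (measurableSet_halfSpace M),
    integral_eq_lintegral_of_nonneg_ae (ae_of_all _ (normalDens_nonneg M b hβ))
      (integrable_normalDens M b hβ).aestronglyMeasurable.restrict]
  simp_rw [normalDens_eq_prod_gaussianPDFReal M b hβ, v]

/-- Lowering the precision from `β` to `β'` decreases the density by a factor of at most
`(β' / β)^{M/2}`. -/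
theorem mul_normalDens_le_normalDens (M : ℕ) (ν : ℝ) {β' β : ℝ} (hβ' : 0 < β') (hββ' : β' ≤ β)
    (z : Fin M → ℝ) :
    (β' / β) ^ ((M : ℝ) / 2) * normalDens M ν β z ≤ normalDens M ν β' z := by
  have hβ : 0 < β := hβ'.trans_le hββ'
  have hexp : Real.exp (-(β / 2) * ∑ i, (z i - ν) ^ 2) ≤
      Real.exp (-(β' / 2) * ∑ i, (z i - ν) ^ 2) := by
    gcongr
  have hpow : (β' / β) ^ ((M : ℝ) / 2) * β ^ ((M : ℝ) / 2) = β' ^ ((M : ℝ) / 2) := by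
    rw [← Real.mul_rpow (by positivity) hβ.le, div_mul_cancel₀ _ hβ.ne']
  calc (β' / β) ^ ((M : ℝ) / 2) * normalDens M ν β z
      = (2 * Real.pi) ^ (-(M : ℝ) / 2) * β' ^ ((M : ℝ) / 2) *
          Real.exp (-(β / 2) * ∑ i, (z i - ν) ^ 2) := by
        rw [← hpow, normalDens]
        ring
    _ ≤ normalDens M ν β' z := by
        rw [normalDens]
        gcongr

/-- for `b > 0`, `M ≥ 1` and `0 < β' ≤ β` with `(β'/β)^{M/2} ≥ M^{−1/2}`,
`∫_{A_2} min{N_M(z; b1_M, β'⁻¹I_M), N_M(z; b1_M, β⁻¹I_M)} dλ(z)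
  ≥ (1/√M) Φ(b √(Mβ)) ≥ 1/(2√M)`. -/
theorem stmt17 (b : ℝ) (hb : 0 < b) (M : ℕ) (hM : 1 ≤ M) (β' β : ℝ)
    (hβ' : 0 < β') (hββ' : β' ≤ β)
    (hratio : (M : ℝ) ^ (-(1 : ℝ) / 2) ≤ (β' / β) ^ ((M : ℝ) / 2)) :
    (1 / Real.sqrt M) * stdNormalCDF (b * Real.sqrt (M * β)) ≤
        ∫ z in halfSpace M, min (normalDens M b β' z) (normalDens M b β z) ∧
      1 / (2 * Real.sqrt M) ≤ (1 / Real.sqrt M) * stdNormalCDF (b * Real.sqrt (M * β)) := by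
  have hβ : 0 < β := hβ'.trans_le hββ'
  have hM1 : (1 : ℝ) ≤ M := by exact_mod_cast hM
  have hs : 1 ≤ Real.sqrt M := Real.one_le_sqrt.mpr hM1
  have hrpow : (M : ℝ) ^ (-(1 : ℝ) / 2) = 1 / Real.sqrt M := by
    rw [neg_div, Real.rpow_neg (by positivity), ← Real.sqrt_eq_rpow, one_div]
  rw [hrpow] at hratio
  constructor
  · rw [← setIntegral_halfSpace_normalDens b hM hβ, ← integral_const_mul]
    refine integral_mono ((integrable_normalDens M b hβ).restrict.const_mul _)
      ((integrable_normalDens M b hβ').inf (integrable_normalDens M b hβ)).restrict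
      fun z => le_min ?_ ?_
    · exact (mul_le_mul_of_nonneg_right hratio (normalDens_nonneg M b hβ z)).trans
        (mul_normalDens_le_normalDens M b hβ' hββ' z)
    · exact mul_le_of_le_one_left (normalDens_nonneg M b hβ z)
        ((div_le_one (by positivity)).mpr hs)
  · have hhalf : 1 / 2 ≤ stdNormalCDF (b * Real.sqrt (M * β)) :=
      half_le_stdNormalCDF (by positivity)
    calc 1 / (2 * Real.sqrt M) = 1 / Real.sqrt M * (1 / 2) := by
          rw [one_div_mul_one_div, mul_comm]
      _ ≤ _ := by gcongr
end
end
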